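/- The SG-generating map α_SG from DAGs to summary graphs is surjective: for every summary graph H there exist a directed acyclic graph G and disjoint subsets M and C of the node set of G such that α_SG(G;M,C) = H. -/

import Mathlib

/-!
Stable mixed graphs: mixed graphs with arrows, arcs and lines; ribbonless,
summary and ancestral graphs; the generating maps α_RG, α_SG, α_AG;
m-connecting paths, m-separation and induced independence models.
-/

namespace StableMixedGraphs

/-- A mixed graph on node type `V`: a node set together with three edge
relations: arrows (`arrow i j` means an arrow from `i` to `j`), arcs
(two-headed, symmetric) and lines (undirected, symmetric). -/
structure MixedGraph (V : Type) where
  nodes : Set V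
  arrow : V → V → Prop
  arc : V → V → Prop
  line : V → V → Prop

namespace MixedGraph

variable {V W : Type}

/-- Wellformedness: arcs and lines are symmetric relations and all edges join
nodes of the graph. -/
def Wf (G : MixedGraph V) : Prop :=
  (∀ i j, G.arc i j → G.arc j i) ∧
  (∀ i j, G.line i j → G.line j i) ∧
  (∀ i j, G.arrow i j ∨ G.arc i j ∨ G.line i j → i ∈ G.nodes ∧ j ∈ G.nodes)

/-- No loops of any of the three kinds. -/
def Loopless (G : MixedGraph V) : Prop :=
  ∀ i, ¬ G.arrow i i ∧ ¬ G.arc i i ∧ ¬ G.line i i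

/-- A loopless mixed graph with a finite node set. -/
def IsLMG (G : MixedGraph V) : Prop := G.Wf ∧ G.Loopless ∧ G.nodes.Finite

/-- `G.anc i j` : `i` is an ancestor of `j`, i.e. there is a
direction-preserving path from `i` to `j`. -/
def anc (G : MixedGraph V) (i j : V) : Prop := Relation.TransGen G.arrow i j

/-- The set of ancestors of nodes of `C`. -/
def anSet (G : MixedGraph V) (C : Set V) : Set V := {a | ∃ c ∈ C, G.anc a c}

/-- `i` lies on a direction-preserving cycle. -/
def OnDPCycle (G : MixedGraph V) (i : V) : Prop := G.anc i i

/-- `i` is an endpoint of a line. -/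
def LineEndpoint (G : MixedGraph V) (i : V) : Prop := ∃ j, G.line i j

/-- Condition (2) of a ribbon: `i` or a descendant of `i` is an endpoint of a
line or lies on a direction-preserving cycle. -/
def RibbonTail (G : MixedGraph V) (i : V) : Prop :=
  ∃ d, (d = i ∨ G.anc i d) ∧ (G.LineEndpoint d ∨ G.OnDPCycle d)

/-- `G` contains a ribbon: a collider V-configuration `⟨h,i,j⟩` with no
endpoint-identical edge between `h` and `j`, whose inner node `i` (or a
descendant of it) is an endpoint of a line or on a direction-preserving
cycle. -/
def HasRibbon (G : MixedGraph V) : Prop :=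
  ∃ h i j, h ≠ i ∧ i ≠ j ∧ h ≠ j ∧ G.RibbonTail i ∧
    ((G.arc h i ∧ G.arc i j ∧ ¬ G.arc h j) ∨
     (G.arrow h i ∧ G.arrow j i ∧ ¬ G.line h j) ∨
     (G.arrow h i ∧ G.arc i j ∧ ¬ G.arrow h j))

/-- A ribbonless graph: a loopless mixed graph with no ribbon. -/
def IsRG (G : MixedGraph V) : Prop := G.IsLMG ∧ ¬ G.HasRibbon

/-- A directed acyclic graph: only arrows, no direction-preserving cycle. -/
def IsDAG (G : MixedGraph V) : Prop :=
  G.IsLMG ∧ (∀ i j, ¬ G.arc i j) ∧ (∀ i j, ¬ G.line i j) ∧ ∀ i, ¬ G.anc i i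

/-- A summary graph: a loopless mixed graph with no arrowhead pointing to an
endpoint of a line and no direction-preserving cycle. -/
def IsSG (G : MixedGraph V) : Prop :=
  G.IsLMG ∧ (∀ i, G.LineEndpoint i → ∀ k, ¬ G.arrow k i ∧ ¬ G.arc k i) ∧
    ∀ i, ¬ G.anc i i

/-- A simple mixed graph: no loops and no multiple edges. -/
def Simple (G : MixedGraph V) : Prop :=
  G.Loopless ∧ ∀ i j,
    (G.arrow i j → ¬ G.arrow j i ∧ ¬ G.arc i j ∧ ¬ G.line i j) ∧
    (G.arc i j → ¬ G.line i j)

/-- An ancestral graph: a simple mixed graph such that no node is an ancestor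
of one of its parents or spouses, and a node with a neighbour has neither
parents nor spouses. -/
def IsAG (G : MixedGraph V) : Prop :=
  G.Wf ∧ G.Simple ∧ G.nodes.Finite ∧
  (∀ i j, G.arrow j i ∨ G.arc j i → ¬ G.anc i j) ∧
  (∀ i, G.LineEndpoint i → ∀ k, ¬ G.arrow k i ∧ ¬ G.arc k i)

/-- An undirected graph: only lines. -/
def IsUG (G : MixedGraph V) : Prop :=
  G.IsLMG ∧ (∀ i j, ¬ G.arrow i j) ∧ ∀ i j, ¬ G.arc i j

/-- A bidirected graph: only arcs. -/
def IsBG (G : MixedGraph V) : Prop :=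
  G.IsLMG ∧ (∀ i j, ¬ G.arrow i j) ∧ ∀ i j, ¬ G.line i j

/-- Image of a mixed graph under a map of node types. -/
def map (f : V → W) (G : MixedGraph V) : MixedGraph W where
  nodes := f '' G.nodes
  arrow a b := ∃ i j, G.arrow i j ∧ f i = a ∧ f j = b
  arc a b := ∃ i j, G.arc i j ∧ f i = a ∧ f j = b
  line a b := ∃ i j, G.line i j ∧ f i = a ∧ f j = b

end MixedGraph

/-! ### The closure generating new edges (Table 1 of the RG-generating
algorithm), for given marginalisation set `M` and collider set
`S = C ∪ an(C)`.  For every V-configuration whose inner node is a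
non-collider in `M` (rows 1–7) or a collider in `S` (rows 8–10) the
endpoint-identical edge between the endpoints is generated, repeatedly
until closure. -/

mutual
  /-- Generated arrows (`GenArrow H M S j i`: arrow from `j` to `i`). -/
  inductive GenArrow {V : Type} (H : MixedGraph V) (M S : Set V) : V → V → Prop
    | base {i j : V} : H.arrow i j → GenArrow H M S i j
    | row1 {i j m : V} : m ∈ M → j ≠ i →
        GenArrow H M S j m → GenArrow H M S m i → GenArrow H M S j i
    | row2 {i j m : V} : m ∈ M → j ≠ i →
        GenLine H M S j m → GenArrow H M S m i → GenArrow H M S j i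
    | row3 {i j m : V} : m ∈ M → j ≠ i →
        GenLine H M S j m → GenArc H M S m i → GenArrow H M S j i
    | row8 {i j s : V} : s ∈ S → j ≠ i →
        GenArrow H M S j s → GenArc H M S s i → GenArrow H M S j i

  /-- Generated arcs. -/
  inductive GenArc {V : Type} (H : MixedGraph V) (M S : Set V) : V → V → Prop
    | base {i j : V} : H.arc i j → GenArc H M S i j
    | symm {i j : V} : GenArc H M S i j → GenArc H M S j i
    | row4 {i j m : V} : m ∈ M → i ≠ j →
        GenArrow H M S m i → GenArrow H M S m j → GenArc H M S i j
    | row5 {i j m : V} : m ∈ M → i ≠ j →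
        GenArrow H M S m i → GenArc H M S m j → GenArc H M S i j
    | row9 {i j s : V} : s ∈ S → i ≠ j →
        GenArc H M S i s → GenArc H M S s j → GenArc H M S i j

  /-- Generated lines. -/
  inductive GenLine {V : Type} (H : MixedGraph V) (M S : Set V) : V → V → Prop
    | base {i j : V} : H.line i j → GenLine H M S i j
    | symm {i j : V} : GenLine H M S i j → GenLine H M S j i
    | row6 {i j m : V} : m ∈ M → i ≠ j →
        GenLine H M S i m → GenArrow H M S j m → GenLine H M S i j
    | row7 {i j m : V} : m ∈ M → i ≠ j →
        GenLine H M S i m → GenLine H M S m j → GenLine H M S i j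
    | row10 {i j s : V} : s ∈ S → i ≠ j →
        GenArrow H M S i s → GenArrow H M S j s → GenLine H M S i j
end

variable {V : Type}

/-- The RG-generating map `α_RG(H;M,C)`: generate all edges of the closure
and delete the nodes of `M ∪ C`. -/
def alphaRG (H : MixedGraph V) (M C : Set V) : MixedGraph V where
  nodes := H.nodes \ (M ∪ C)
  arrow i j := i ∈ H.nodes \ (M ∪ C) ∧ j ∈ H.nodes \ (M ∪ C) ∧
    GenArrow H M (C ∪ H.anSet C) i j
  arc i j := i ∈ H.nodes \ (M ∪ C) ∧ j ∈ H.nodes \ (M ∪ C) ∧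
    GenArc H M (C ∪ H.anSet C) i j
  line i j := i ∈ H.nodes \ (M ∪ C) ∧ j ∈ H.nodes \ (M ∪ C) ∧
    GenLine H M (C ∪ H.anSet C) i j

/-- The arrowhead-removal operation `α_RG.SG(K;A)`: every arrowhead pointing
at a node of `A` is removed (an arrow at such a node becomes a line, an arc
becomes an arrow, an arc with both endpoints in `A` becomes a line),
repeatedly until closure. -/
def deheadAt (K : MixedGraph V) (A : Set V) : MixedGraph V where
  nodes := K.nodes
  arrow j i := i ∉ A ∧ (K.arrow j i ∨ (K.arc j i ∧ j ∈ A))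
  arc i j := K.arc i j ∧ i ∉ A ∧ j ∉ A
  line i j := K.line i j ∨ (K.arrow j i ∧ i ∈ A) ∨ (K.arrow i j ∧ j ∈ A) ∨
    (K.arc i j ∧ i ∈ A ∧ j ∈ A)

/-- The SG-generating map `α_SG(H;M,C)`: mark the nodes of `an(C)`, apply the
RG-generating construction, then remove all arrowheads pointing at marked
nodes. -/
def alphaSG (H : MixedGraph V) (M C : Set V) : MixedGraph V :=
  deheadAt (alphaRG H M C) (H.anSet C)

/-! ### Step 2 of the AG-generating algorithm: for every V-configuration
`j → k ↔ i` or `j ↔ k ↔ i` with `k ∈ an(i)` (in the current graph) generate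
an arrow from `j` to `i`, respectively an arc between `j` and `i`, until
closure. -/

mutual
  inductive AG2Arrow {V : Type} (K : MixedGraph V) : V → V → Prop
    | base {i j : V} : K.arrow j i → AG2Arrow K j i
    | gen {i j k : V} : j ≠ i → AG2Arrow K j k → AG2Arc K k i →
        AG2Anc K k i → AG2Arrow K j i

  inductive AG2Arc {V : Type} (K : MixedGraph V) : V → V → Prop
    | base {i j : V} : K.arc i j → AG2Arc K i j
    | symm {i j : V} : AG2Arc K i j → AG2Arc K j i
    | gen {i j k : V} : j ≠ i → AG2Arc K j k → AG2Arc K k i →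
        AG2Anc K k i → AG2Arc K j i

  /-- The ancestor relation of the graph being generated in step 2. -/
  inductive AG2Anc {V : Type} (K : MixedGraph V) : V → V → Prop
    | single {i j : V} : AG2Arrow K i j → AG2Anc K i j
    | tail {i k j : V} : AG2Arrow K i k → AG2Anc K k j → AG2Anc K i j
end

/-- The graph after step 2 of the AG-generating algorithm. -/
def ag2 (K : MixedGraph V) : MixedGraph V where
  nodes := K.nodes
  arrow := AG2Arrow K
  arc := AG2Arc K
  line := K.line

/-! ### Step 3 of the AG-generating algorithm: repeatedly replace every arc
between `j` and `i` with `j ∈ an(i)` (in the current graph) by an arrow from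
`j` to `i`. -/

mutual
  inductive AG3Arrow {V : Type} (K : MixedGraph V) : V → V → Prop
    | base {i j : V} : K.arrow j i → AG3Arrow K j i
    | conv {i j : V} : K.arc j i → AG3Anc K j i → AG3Arrow K j i

  /-- The ancestor relation of the graph being generated in step 3. -/
  inductive AG3Anc {V : Type} (K : MixedGraph V) : V → V → Prop
    | single {i j : V} : AG3Arrow K i j → AG3Anc K i j
    | tail {i k j : V} : AG3Arrow K i k → AG3Anc K k j → AG3Anc K i j
end

/-- Steps 2 and 3 of the AG-generating algorithm, applied to a summary
graph: `α_SG.AG`. -/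
def alphaSGAG (K : MixedGraph V) : MixedGraph V :=
  let K2 := ag2 K
  { nodes := K.nodes
    arrow := AG3Arrow K2
    arc := fun i j => K2.arc i j ∧ ¬ AG3Anc K2 i j ∧ ¬ AG3Anc K2 j i
    line := K.line }

/-- The AG-generating map `α_AG(H;M,C)`. -/
def alphaAG (H : MixedGraph V) (M C : Set V) : MixedGraph V :=
  alphaSGAG (alphaSG H M C)

/-! ### Paths, m-connection and m-separation. -/

/-- A step of a walk: it goes from `src` to `tgt` along an edge which has an
arrowhead at `src` iff `hs = true` and an arrowhead at `tgt` iff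
`ht = true` (so `hs = ht = false` is a line, `hs = ht = true` an arc, and
exactly one head an arrow in the corresponding direction). -/
structure Step (V : Type) where
  src : V
  tgt : V
  hs : Bool
  ht : Bool

/-- The edge of a step is present in `G`. -/
def Step.valid (G : MixedGraph V) (s : Step V) : Prop :=
  match s.hs, s.ht with
  | false, false => G.line s.src s.tgt
  | false, true  => G.arrow s.src s.tgt
  | true,  false => G.arrow s.tgt s.src
  | true,  true  => G.arc s.src s.tgt

/-- `w` is a path from `i` to `j` in `G`: a nonempty chained list of valid
steps with no repeated nodes. -/
def IsPath (G : MixedGraph V) (i j : V) (w : List (Step V)) : Prop :=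
  w ≠ [] ∧ (∀ s ∈ w, s.valid G) ∧ List.Chain' (fun a b => a.tgt = b.src) w ∧
    w.head?.map Step.src = some i ∧ w.getLast?.map Step.tgt = some j ∧
    (i :: w.map Step.tgt).Nodup

/-- The path `w` is m-connecting given `M` and `C`: every inner collider node
is in `C ∪ an(C)` and every inner non-collider node is in `M`. -/
def MConnPath (G : MixedGraph V) (M C : Set V) (w : List (Step V)) : Prop :=
  List.Chain'
    (fun a b =>
      (a.ht = true ∧ b.hs = true → a.tgt ∈ C ∪ G.anSet C) ∧
      (¬ (a.ht = true ∧ b.hs = true) → a.tgt ∈ M)) w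

/-- `A ⊥_m B | C` in `G` : there is no m-connecting path between `A` and `B`
given `C` (with `M` the remaining nodes). -/
def MSep (G : MixedGraph V) (A B C : Set V) : Prop :=
  ∀ i ∈ A, ∀ j ∈ B, ∀ w : List (Step V),
    IsPath G i j w → ¬ MConnPath G (G.nodes \ (A ∪ B ∪ C)) C w

/-- The independence model induced by `G` via m-separation: the set of
triples `⟨A,B|C⟩` of pairwise disjoint subsets of the nodes with
`A ⊥_m B | C`. -/
def Jm (G : MixedGraph V) : Set (Set V × Set V × Set V) :=
  {t | t.1 ⊆ G.nodes ∧ t.2.1 ⊆ G.nodes ∧ t.2.2 ⊆ G.nodes ∧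
    Disjoint t.1 t.2.1 ∧ Disjoint t.1 t.2.2 ∧ Disjoint t.2.1 t.2.2 ∧
    MSep G t.1 t.2.1 t.2.2}

/-- The independence model after marginalisation over `M` and conditioning on
`C` : `α(J;M,C)`. -/
def alphaIM (J : Set (Set V × Set V × Set V)) (M C : Set V) :
    Set (Set V × Set V × Set V) :=
  {t | (t.1, t.2.1, t.2.2 ∪ C) ∈ J ∧ (t.1 ∪ t.2.1 ∪ t.2.2) ∩ (M ∪ C) = ∅}

section Closure

variable {W : Type} {G : MixedGraph W} {M S : Set W} {A L : W → W → Prop}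

/-- Over-approximation of the generating closure: if nothing points into `M`, the arc relation `A`
avoids `M` and `S`, the line relation `L` avoids `M`, common parents in `M` are recorded by `A` and
common children in `S` by `L`, then no new arrows arise and all generated arcs and lines lie in
`A` and `L`. -/
structure ClosureBound (G : MixedGraph W) (M S : Set W) (A L : W → W → Prop) : Prop where
  arc_le : ∀ {i j}, G.arc i j → A i j
  line_le : ∀ {i j}, G.line i j → L i j
  arc_symm : ∀ {i j}, A i j → A j i
  line_symm : ∀ {i j}, L i j → L j i
  no_arrow : ∀ {i m}, m ∈ M → ¬ G.arrow i m
  arc_notMem : ∀ {i j}, A i j → i ∉ M ∧ i ∉ S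
  line_notMem : ∀ {i j}, L i j → i ∉ M
  common_parent : ∀ {i j m}, m ∈ M → i ≠ j → G.arrow m i → G.arrow m j → A i j
  common_child : ∀ {i j s}, s ∈ S → i ≠ j → G.arrow i s → G.arrow j s → L i j

mutual

theorem GenArrow.arrow_of_bound (h : ClosureBound G M S A L) {i j : W} :
    GenArrow G M S i j → G.arrow i j
  | .base hij => hij
  | .row1 hm _ hjm _ => absurd (GenArrow.arrow_of_bound h hjm) (h.no_arrow hm)
  | .row2 hm _ hjm _ =>
    absurd hm (h.line_notMem (h.line_symm (GenLine.mem_of_bound h hjm)))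
  | .row3 hm _ hjm _ =>
    absurd hm (h.line_notMem (h.line_symm (GenLine.mem_of_bound h hjm)))
  | .row8 hs _ _ hsi => absurd hs (h.arc_notMem (GenArc.mem_of_bound h hsi)).2

theorem GenArc.mem_of_bound (h : ClosureBound G M S A L) {i j : W} :
    GenArc G M S i j → A i j
  | .base hij => h.arc_le hij
  | .symm hij => h.arc_symm (GenArc.mem_of_bound h hij)
  | .row4 hm hne hi hj =>
    h.common_parent hm hne (GenArrow.arrow_of_bound h hi) (GenArrow.arrow_of_bound h hj)
  | .row5 hm _ _ hmj => absurd hm (h.arc_notMem (GenArc.mem_of_bound h hmj)).1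
  | .row9 hs _ _ hsj => absurd hs (h.arc_notMem (GenArc.mem_of_bound h hsj)).2

theorem GenLine.mem_of_bound (h : ClosureBound G M S A L) {i j : W} :
    GenLine G M S i j → L i j
  | .base hij => h.line_le hij
  | .symm hij => h.line_symm (GenLine.mem_of_bound h hij)
  | .row6 hm _ him _ =>
    absurd hm (h.line_notMem (h.line_symm (GenLine.mem_of_bound h him)))
  | .row7 hm _ _ hmj => absurd hm (h.line_notMem (GenLine.mem_of_bound h hmj))
  | .row10 hs hne hi hj =>
    h.common_child hs hne (GenArrow.arrow_of_bound h hi) (GenArrow.arrow_of_bound h hj)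

end

end Closure

namespace MixedGraph

/-- The latent nodes, one for every arc of `H`, named by `p`. -/
def latents (H : MixedGraph V) (p : V → V → ℕ) : Set (V ⊕ ℕ) :=
  {x | ∃ a b, H.arc a b ∧ x = Sum.inr (p a b)}

/-- The selection nodes, one for every line of `H`, named by `q`. -/
def selections (H : MixedGraph V) (q : V → V → ℕ) : Set (V ⊕ ℕ) :=
  {x | ∃ a b, H.line a b ∧ x = Sum.inr (q a b)}

/-- The graph obtained from `H` by replacing every arc by a common parent of its endpoints and every
line by a common child. -/
def canonicalDAG (H : MixedGraph V) (p q : V → V → ℕ) : MixedGraph (V ⊕ ℕ) where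
  nodes := Sum.inl '' H.nodes ∪ (H.latents p ∪ H.selections q)
  arrow
    | .inl i, .inl j => H.arrow i j
    | .inr n, .inl i => ∃ a b, H.arc a b ∧ n = p a b ∧ (i = a ∨ i = b)
    | .inl i, .inr n => ∃ a b, H.line a b ∧ n = q a b ∧ (i = a ∨ i = b)
    | .inr _, .inr _ => False
  arc _ _ := False
  line _ _ := False

variable {H : MixedGraph V} {p q : V → V → ℕ}

theorem not_canonicalDAG_arrow_latent (hpq : ∀ a b c d, p a b ≠ q c d) {x m : V ⊕ ℕ}
    (hm : m ∈ H.latents p) : ¬ (H.canonicalDAG p q).arrow x m := by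
  obtain ⟨a, b, -, rfl⟩ := hm
  rcases x with x | x
  · rintro ⟨c, d, -, h, -⟩
    exact hpq _ _ _ _ h
  · exact id

theorem not_canonicalDAG_arrow_lineEndpoint (hW : H.Wf)
    (hL : ∀ i, H.LineEndpoint i → ∀ k, ¬ H.arrow k i ∧ ¬ H.arc k i) {x : V ⊕ ℕ} {i : V}
    (hi : H.LineEndpoint i) : ¬ (H.canonicalDAG p q).arrow x (Sum.inl i) := by
  rcases x with x | x
  · exact (hL i hi x).1
  · rintro ⟨a, b, hab, -, rfl | rfl⟩
    · exact (hL _ hi b).2 (hW.1 _ _ hab)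
    · exact (hL _ hi a).2 hab

theorem canonicalDAG_arrow_latent {x y : V ⊕ ℕ} {n : ℕ} (hx : x = Sum.inr n)
    (h : (H.canonicalDAG p q).arrow x y) :
    x ∈ H.latents p := by
  subst hx
  rcases y with y | y
  · obtain ⟨a, b, hab, rfl, -⟩ := h
    exact ⟨a, b, hab, rfl⟩
  · exact h.elim

theorem canonicalDAG_not_anc_latent (hpq : ∀ a b c d, p a b ≠ q c d) {x m : V ⊕ ℕ}
    (hm : m ∈ H.latents p) : ¬ (H.canonicalDAG p q).anc x m := fun h => by
  obtain ⟨b, -, hb⟩ := Relation.TransGen.tail'_iff.1 h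
  exact not_canonicalDAG_arrow_latent hpq hm hb

theorem anc_of_canonicalDAG_anc (hpq : ∀ a b c d, p a b ≠ q c d) {i j : V}
    (h : (H.canonicalDAG p q).anc (Sum.inl i) (Sum.inl j)) : H.anc i j := by
  generalize hy : (Sum.inl j : V ⊕ ℕ) = y at h
  induction h generalizing j with
  | single h => subst hy; exact .single h
  | @tail b c hb hbc ih =>
    subst hy
    rcases b with k | n
    · exact (ih rfl).tail hbc
    · exact (canonicalDAG_not_anc_latent hpq (canonicalDAG_arrow_latent rfl hbc) hb).elim

theorem canonicalDAG_not_anc_self (hpq : ∀ a b c d, p a b ≠ q c d) (hH : ∀ i, ¬ H.anc i i)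
    (x : V ⊕ ℕ) : ¬ (H.canonicalDAG p q).anc x x := by
  intro h
  rcases x with i | n
  · exact hH i (anc_of_canonicalDAG_anc hpq h)
  · obtain ⟨b, hb, -⟩ := Relation.TransGen.head'_iff.1 h
    exact canonicalDAG_not_anc_latent hpq (canonicalDAG_arrow_latent rfl hb) h

theorem canonicalDAG_finite_nodes (hH : H.IsLMG) : (H.canonicalDAG p q).nodes.Finite := by
  obtain ⟨⟨-, -, hW⟩, -, hF⟩ := hH
  refine (hF.image _).union (.union ?_ ?_)
  · refine (hF.image2 (fun a b => (Sum.inr (p a b) : V ⊕ ℕ)) hF).subset ?_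
    rintro _ ⟨a, b, hab, rfl⟩
    obtain ⟨ha, hb⟩ := hW a b (.inr (.inl hab))
    exact ⟨a, ha, b, hb, rfl⟩
  · refine (hF.image2 (fun a b => (Sum.inr (q a b) : V ⊕ ℕ)) hF).subset ?_
    rintro _ ⟨a, b, hab, rfl⟩
    obtain ⟨ha, hb⟩ := hW a b (.inr (.inr hab))
    exact ⟨a, ha, b, hb, rfl⟩

theorem canonicalDAG_isDAG (hH : H.IsLMG) (hpq : ∀ a b c d, p a b ≠ q c d)
    (hac : ∀ i, ¬ H.anc i i) : (H.canonicalDAG p q).IsDAG := by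
  have hself := canonicalDAG_not_anc_self hpq hac
  refine ⟨⟨⟨fun _ _ => id, fun _ _ => id, ?_⟩, fun x => ⟨fun h => hself x (.single h), id, id⟩,
    canonicalDAG_finite_nodes hH⟩, fun _ _ => id, fun _ _ => id, hself⟩
  obtain ⟨⟨-, -, hW⟩, -, -⟩ := hH
  rintro (i | n) (j | m) (h | h | h) <;> try exact h.elim
  · obtain ⟨hi, hj⟩ := hW i j (.inl h)
    exact ⟨.inl ⟨i, hi, rfl⟩, .inl ⟨j, hj, rfl⟩⟩
  · obtain ⟨a, b, hab, rfl, hi⟩ := h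
    obtain ⟨ha, hb⟩ := hW a b (.inr (.inr hab))
    refine ⟨.inl ⟨i, ?_, rfl⟩, .inr (.inr ⟨a, b, hab, rfl⟩)⟩
    rcases hi with rfl | rfl <;> assumption
  · obtain ⟨a, b, hab, rfl, hi⟩ := h
    obtain ⟨ha, hb⟩ := hW a b (.inr (.inl hab))
    refine ⟨.inr (.inl ⟨a, b, hab, rfl⟩), .inl ⟨j, ?_, rfl⟩⟩
    rcases hi with rfl | rfl <;> assumption

theorem canonicalDAG_anSet_selections (hH : H.IsSG) :
    (H.canonicalDAG p q).anSet (H.selections q) = Sum.inl '' {i | H.LineEndpoint i} := by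
  obtain ⟨⟨hW, -, -⟩, hL, -⟩ := hH
  ext x
  constructor
  · rintro ⟨_, ⟨a, b, -, rfl⟩, h⟩
    obtain ⟨y, hxy, hy⟩ := Relation.TransGen.tail'_iff.1 h
    rcases y with i | n
    swap
    · exact hy.elim
    have hi : H.LineEndpoint i := by
      obtain ⟨c, d, hcd, -, rfl | rfl⟩ := hy
      · exact ⟨d, hcd⟩
      · exact ⟨c, hW.2.1 _ _ hcd⟩
    rcases Relation.ReflTransGen.cases_tail hxy with h | ⟨z, -, hz⟩
    · exact ⟨i, hi, h⟩
    · exact (not_canonicalDAG_arrow_lineEndpoint hW hL hi hz).elim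
  · rintro ⟨i, ⟨j, hij⟩, rfl⟩
    exact ⟨_, ⟨i, j, hij, rfl⟩, .single ⟨i, j, hij, rfl, .inl rfl⟩⟩

theorem canonicalDAG_closureBound (hH : H.IsSG) (hpq : ∀ a b c d, p a b ≠ q c d)
    (hp : ∀ a ∈ H.nodes, ∀ b ∈ H.nodes, ∀ c ∈ H.nodes, ∀ d ∈ H.nodes,
      p a b = p c d → a = c ∧ b = d)
    (hq : ∀ a ∈ H.nodes, ∀ b ∈ H.nodes, ∀ c ∈ H.nodes, ∀ d ∈ H.nodes,
      q a b = q c d → a = c ∧ b = d) :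
    ClosureBound (H.canonicalDAG p q) (H.latents p)
      (H.selections q ∪ (H.canonicalDAG p q).anSet (H.selections q))
      (H.map Sum.inl).arc (H.map Sum.inl).line := by
  rw [canonicalDAG_anSet_selections hH]
  obtain ⟨⟨hW, -, -⟩, hL, -⟩ := hH
  refine ⟨False.elim, False.elim, ?_, ?_, not_canonicalDAG_arrow_latent hpq, ?_, ?_, ?_, ?_⟩
  · rintro _ _ ⟨i, j, h, rfl, rfl⟩
    exact ⟨j, i, hW.1 _ _ h, rfl, rfl⟩
  · rintro _ _ ⟨i, j, h, rfl, rfl⟩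
    exact ⟨j, i, hW.2.1 _ _ h, rfl, rfl⟩
  · rintro _ _ ⟨i, j, h, rfl, rfl⟩
    refine ⟨fun ⟨_, _, _, h'⟩ => Sum.inl_ne_inr h', ?_⟩
    rintro (⟨_, _, _, h'⟩ | ⟨k, hk, h'⟩)
    · exact Sum.inl_ne_inr h'
    · obtain rfl := Sum.inl_injective h'
      exact (hL k hk j).2 (hW.1 _ _ h)
  · rintro _ _ ⟨i, j, h, rfl, rfl⟩ ⟨_, _, _, h'⟩
    exact Sum.inl_ne_inr h'
  · rintro (i | _) (j | _) _ ⟨a, b, hab, rfl⟩ hne hi hj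
    · obtain ⟨ha, hb⟩ := hW.2.2 a b (.inr (.inl hab))
      obtain ⟨c, d, hcd, e, hi⟩ := hi
      obtain ⟨hc, hd⟩ := hW.2.2 c d (.inr (.inl hcd))
      obtain ⟨rfl, rfl⟩ := hp _ ha _ hb _ hc _ hd e
      obtain ⟨c, d, hcd, e, hj⟩ := hj
      obtain ⟨hc, hd⟩ := hW.2.2 c d (.inr (.inl hcd))
      obtain ⟨rfl, rfl⟩ := hp _ ha _ hb _ hc _ hd e
      have := hW.1 _ _ hab
      refine ⟨i, j, ?_, rfl, rfl⟩
      rcases hi with rfl | rfl <;> rcases hj with rfl | rfl <;>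
        first | assumption | exact (hne rfl).elim
    all_goals first | exact hi.elim | exact hj.elim
  · rintro i j _ (⟨a, b, hab, rfl⟩ | ⟨k, hk, rfl⟩) hne hi hj
    · rcases i with i | _
      swap
      · exact hi.elim
      rcases j with j | _
      swap
      · exact hj.elim
      obtain ⟨ha, hb⟩ := hW.2.2 a b (.inr (.inr hab))
      obtain ⟨c, d, hcd, e, hi⟩ := hi
      obtain ⟨hc, hd⟩ := hW.2.2 c d (.inr (.inr hcd))
      obtain ⟨rfl, rfl⟩ := hq _ ha _ hb _ hc _ hd e
      obtain ⟨c, d, hcd, e, hj⟩ := hj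
      obtain ⟨hc, hd⟩ := hW.2.2 c d (.inr (.inr hcd))
      obtain ⟨rfl, rfl⟩ := hq _ ha _ hb _ hc _ hd e
      have := hW.2.1 _ _ hab
      refine ⟨i, j, ?_, rfl, rfl⟩
      rcases hi with rfl | rfl <;> rcases hj with rfl | rfl <;>
        first | assumption | exact (hne rfl).elim
    · exact (not_canonicalDAG_arrow_lineEndpoint hW hL hk hi).elim

theorem canonicalDAG_nodes_diff :
    (H.canonicalDAG p q).nodes \ (H.latents p ∪ H.selections q) = Sum.inl '' H.nodes := by
  ext x
  constructor
  · rintro ⟨h | h, h'⟩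
    · exact h
    · exact (h' h).elim
  · rintro ⟨i, hi, rfl⟩
    refine ⟨.inl ⟨i, hi, rfl⟩, ?_⟩
    rintro (⟨_, _, _, h⟩ | ⟨_, _, _, h⟩) <;> exact Sum.inl_ne_inr h

theorem alphaRG_canonicalDAG (hH : H.IsSG) (hpq : ∀ a b c d, p a b ≠ q c d)
    (hp : ∀ a ∈ H.nodes, ∀ b ∈ H.nodes, ∀ c ∈ H.nodes, ∀ d ∈ H.nodes,
      p a b = p c d → a = c ∧ b = d)
    (hq : ∀ a ∈ H.nodes, ∀ b ∈ H.nodes, ∀ c ∈ H.nodes, ∀ d ∈ H.nodes,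
      q a b = q c d → a = c ∧ b = d) :
    alphaRG (H.canonicalDAG p q) (H.latents p) (H.selections q) = H.map Sum.inl := by
  have hB := canonicalDAG_closureBound hH hpq hp hq
  obtain ⟨⟨hW, hl, -⟩, -, -⟩ := hH
  unfold alphaRG
  simp only [canonicalDAG_nodes_diff]
  simp only [map, mk.injEq, true_and]
  refine ⟨?_, ?_, ?_⟩ <;> funext x y <;> refine propext ⟨?_, ?_⟩
  · rintro ⟨⟨i, -, rfl⟩, ⟨j, -, rfl⟩, h⟩
    exact ⟨i, j, h.arrow_of_bound hB, rfl, rfl⟩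
  · rintro ⟨i, j, h, rfl, rfl⟩
    obtain ⟨hi, hj⟩ := hW.2.2 i j (.inl h)
    exact ⟨⟨i, hi, rfl⟩, ⟨j, hj, rfl⟩, .base h⟩
  · rintro ⟨-, -, h⟩
    exact h.mem_of_bound hB
  · rintro ⟨i, j, h, rfl, rfl⟩
    obtain ⟨hi, hj⟩ := hW.2.2 i j (.inr (.inl h))
    refine ⟨⟨i, hi, rfl⟩, ⟨j, hj, rfl⟩, .row4 ⟨i, j, h, rfl⟩ ?_ (.base ?_) (.base ?_)⟩
    · exact fun e => (hl i).2.1 (by rwa [← Sum.inl_injective e] at h)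
    · exact ⟨i, j, h, rfl, .inl rfl⟩
    · exact ⟨i, j, h, rfl, .inr rfl⟩
  · rintro ⟨-, -, h⟩
    exact h.mem_of_bound hB
  · rintro ⟨i, j, h, rfl, rfl⟩
    obtain ⟨hi, hj⟩ := hW.2.2 i j (.inr (.inr h))
    refine ⟨⟨i, hi, rfl⟩, ⟨j, hj, rfl⟩, .row10 (.inl ⟨i, j, h, rfl⟩) ?_ (.base ?_) (.base ?_)⟩
    · exact fun e => (hl i).2.2 (by rwa [← Sum.inl_injective e] at h)
    · exact ⟨i, j, h, rfl, .inl rfl⟩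
    · exact ⟨i, j, h, rfl, .inr rfl⟩

end MixedGraph

/-- Removing arrowheads at nodes without arrowheads changes nothing. -/
theorem deheadAt_eq_self {W : Type} {K : MixedGraph W} {A : Set W}
    (harc : ∀ i j, K.arc i j → K.arc j i) (hA : ∀ i ∈ A, ∀ k, ¬ K.arrow k i ∧ ¬ K.arc k i) :
    deheadAt K A = K := by
  obtain ⟨N, r, a, l⟩ := K
  simp only [deheadAt, MixedGraph.mk.injEq, true_and]
  simp only at harc hA
  refine ⟨?_, ?_, ?_⟩ <;> funext i j <;> refine propext ⟨?_, ?_⟩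
  · rintro ⟨-, h | ⟨h, hi⟩⟩
    · exact h
    · exact ((hA _ hi _).2 (harc _ _ h)).elim
  · exact fun h => ⟨fun hj => (hA _ hj _).1 h, .inl h⟩
  · exact fun h => h.1
  · exact fun h => ⟨h, fun hi => (hA _ hi _).2 (harc _ _ h), fun hj => (hA _ hj _).2 h⟩
  · rintro (h | ⟨h, hi⟩ | ⟨h, hj⟩ | ⟨h, -, hj⟩)
    · exact h
    · exact ((hA _ hi _).1 h).elim
    · exact ((hA _ hj _).1 h).elim
    · exact ((hA _ hj _).2 h).elim
  · exact .inl

/-- (Proposition 5) The map `α_SG` from DAGs to summary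
graphs is surjective: every summary graph `H` is of the form `α_SG(G;M,C)`
for some DAG `G` (possibly on a larger node set) and disjoint subsets `M`,
`C` of its node set. -/
theorem stmt_10 {V : Type} (H : MixedGraph V) (hH : H.IsSG) :
    ∃ (G : MixedGraph (V ⊕ ℕ)) (M C : Set (V ⊕ ℕ)),
      G.IsDAG ∧ M ⊆ G.nodes ∧ C ⊆ G.nodes ∧ Disjoint M C ∧
      alphaSG G M C = H.map Sum.inl := by
  obtain ⟨e, he⟩ := Set.countable_iff_exists_injOn.1 hH.1.2.2.countable
  let p : V → V → ℕ := fun a b => 2 * Nat.pair (e a) (e b)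
  let q : V → V → ℕ := fun a b => 2 * Nat.pair (e a) (e b) + 1
  have hpq : ∀ a b c d, p a b ≠ q c d := fun a b c d => by simp only [p, q]; omega
  have hpair : ∀ a ∈ H.nodes, ∀ b ∈ H.nodes, ∀ c ∈ H.nodes, ∀ d ∈ H.nodes,
      Nat.pair (e a) (e b) = Nat.pair (e c) (e d) → a = c ∧ b = d :=
    fun a ha b hb c hc d hd h =>
      let h' := Nat.pair_eq_pair.1 h
      ⟨he ha hc h'.1, he hb hd h'.2⟩
  refine ⟨H.canonicalDAG p q, H.latents p, H.selections q,
    MixedGraph.canonicalDAG_isDAG hH.1 hpq hH.2.2, fun _ h => .inr (.inl h),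
    fun _ h => .inr (.inr h), ?_, ?_⟩
  · rw [Set.disjoint_left]
    rintro _ ⟨a, b, -, rfl⟩ ⟨c, d, -, h⟩
    exact hpq _ _ _ _ (Sum.inr_injective h)
  · rw [alphaSG, MixedGraph.canonicalDAG_anSet_selections hH,
      MixedGraph.alphaRG_canonicalDAG hH hpq
        (fun a ha b hb c hc d hd h => hpair a ha b hb c hc d hd (by simp only [p] at h; omega))
        (fun a ha b hb c hc d hd h => hpair a ha b hb c hc d hd (by simp only [q] at h; omega))]
    refine deheadAt_eq_self ?_ ?_
    · rintro _ _ ⟨i, j, h, rfl, rfl⟩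
      exact ⟨j, i, hH.1.1.1 _ _ h, rfl, rfl⟩
    · rintro _ ⟨i, hi, rfl⟩ _
      constructor
      · rintro ⟨k, j, h, rfl, e⟩
        obtain rfl := Sum.inl_injective e
        exact (hH.2.1 _ hi k).1 h
      · rintro ⟨k, j, h, rfl, e⟩
        obtain rfl := Sum.inl_injective e
        exact (hH.2.1 _ hi k).2 h

end StableMixedGraphs
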